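/- Proposition 2 (optimality of single-user transmission for the Lagrangian): let K ≥ 1, c > 0, P > 0 and G_1,…,G_K > 0; set D = c + P·Σ_{j=1}^K G_j and λ_i = G_i/D for each i. Fix k ∈ {1,…,K} and let γ_1,…,γ_K be reals with 0 ≤ γ_i ≤ G_i for all i and γ_k = G_k. Define f(p) = ln(1 + (Σ_{i=1}^K p_i γ_i)/c) − Σ_{i=1}^K λ_i p_i for p ∈ [0,∞)^K, and let p* ∈ [0,∞)^K be given by p*_k = P·(Σ_{j=1}^K G_j)/G_k and p*_i = 0 for i ≠ k. Then f(p*) ≥ f(p) for every p ∈ [0,∞)^K, and f(p*) = ln(D/c) − P·(Σ_{j=1}^K G_j)/D. -/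

import Mathlib

/-- Proposition 2: optimality of single-user transmission for the
Lagrangian. With dual variables `λ i = G i / D`, `D = c + P ∑ j, G j`, gains
`γ i ≤ G i` with equality for user `k`, the single-user power allocation `p*`
(only `p* k = P (∑ j, G j) / G k` nonzero) maximizes the Lagrangian
`f(p) = ln(1 + (∑ i, p i γ i)/c) − ∑ i, λ i p i` over the nonnegative orthant, achieving
the value `ln(D/c) − P (∑ j, G j)/D`. -/
theorem single_user_maximizes_lagrangian
    (K : ℕ) (hK : 1 ≤ K) (c P : ℝ) (hc : 0 < c) (hP : 0 < P)
    (G : Fin K → ℝ) (hG : ∀ i, 0 < G i)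
    (D : ℝ) (hD : D = c + P * ∑ j, G j)
    (lam : Fin K → ℝ) (hlam : ∀ i, lam i = G i / D)
    (k : Fin K) (γ : Fin K → ℝ)
    (hγ : ∀ i, 0 ≤ γ i ∧ γ i ≤ G i) (hγk : γ k = G k)
    (f : (Fin K → ℝ) → ℝ)
    (hf : ∀ p : Fin K → ℝ,
      f p = Real.log (1 + (∑ i, p i * γ i) / c) - ∑ i, lam i * p i)
    (pstar : Fin K → ℝ)
    (hpsk : pstar k = P * (∑ j, G j) / G k)
    (hpsi : ∀ i, i ≠ k → pstar i = 0) :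
    (∀ p : Fin K → ℝ, (∀ i, 0 ≤ p i) → f p ≤ f pstar) ∧
    f pstar = Real.log (D / c) - P * (∑ j, G j) / D := by
  have hS : 0 < ∑ j, G j := Finset.sum_pos (fun i _ => hG i) ⟨k, Finset.mem_univ k⟩
  have hGk := hG k
  have hD0 : 0 < D := by rw [hD]; positivity
  have h1 : ∑ i, pstar i * γ i = P * ∑ j, G j := by
    rw [Finset.sum_eq_single k (fun i _ hi => by rw [hpsi i hi, zero_mul]) (by simp),
      hpsk, hγk]
    field_simp
  have h2 : ∑ i, lam i * pstar i = P * (∑ j, G j) / D := by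
    rw [Finset.sum_eq_single k (fun i _ hi => by rw [hpsi i hi, mul_zero]) (by simp),
      hpsk, hlam]
    field_simp
  have hval : f pstar = Real.log (D / c) - P * (∑ j, G j) / D := by
    rw [hf, h1, h2]
    congr 2
    rw [hD]
    field_simp
  refine ⟨fun p hp => ?_, hval⟩
  rw [hval, hf]
  have hs : 0 ≤ ∑ i, p i * γ i := Finset.sum_nonneg fun i _ => mul_nonneg (hp i) (hγ i).1
  have hle : (∑ i, p i * γ i) / D ≤ ∑ i, lam i * p i := by
    rw [Finset.sum_div]
    refine Finset.sum_le_sum fun i _ => ?_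
    rw [hlam, div_mul_eq_mul_div, mul_comm (p i)]
    have := mul_le_mul_of_nonneg_right (hγ i).2 (hp i)
    gcongr
  generalize (∑ i, p i * γ i) = s at *
  have e1 : 1 + s / c = ((c + s) / D) * (D / c) := by field_simp
  have hpos : 0 < (c + s) / D := by positivity
  have hlog := Real.log_le_sub_one_of_pos hpos
  rw [e1, Real.log_mul hpos.ne' (by positivity)]
  have e2 : (c + s) / D - 1 = s / D - P * (∑ j, G j) / D := by
    field_simp
    rw [hD]
    ring
  linarith
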